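/- Let (X,d) be a compact metric space, f : X → X a continuous map, and i ≥ 1. Then the set 𝒞(f) of chain components of f is finite if and only if the set 𝒞(f^i) of chain components of f^i is finite. -/

import Mathlib

open Metric Set Function

/-- A finite sequence `c 0, c 1, ..., c k` (with `k ≥ 1`) is a `δ`-chain of `f` if
`dist (f (c i)) (c (i+1)) ≤ δ` for all `0 ≤ i ≤ k-1`. -/
def IsDeltaChain {X : Type*} [MetricSpace X] (f : X → X) (δ : ℝ) (c : ℕ → X) (k : ℕ) : Prop :=
  1 ≤ k ∧ ∀ i < k, dist (f (c i)) (c (i + 1)) ≤ δ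

/-- `x → y` : for every `δ > 0` there is a `δ`-chain of `f` from `x` to `y`. -/
def ChainReach {X : Type*} [MetricSpace X] (f : X → X) (x y : X) : Prop :=
  ∀ δ : ℝ, 0 < δ → ∃ (c : ℕ → X) (k : ℕ), IsDeltaChain f δ c k ∧ c 0 = x ∧ c k = y

/-- The chain recurrent set `CR(f) = {x | x → x}`. -/
def chainRecurrentSet {X : Type*} [MetricSpace X] (f : X → X) : Set X :=
  {x | ChainReach f x x}

/-- The set of chain components of `f`: equivalence classes of `↔` on `CR(f)`. -/
def chainComponents {X : Type*} [MetricSpace X] (f : X → X) : Set (Set X) :=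
  {C | ∃ x ∈ chainRecurrentSet f,
    C = {y ∈ chainRecurrentSet f | ChainReach f x y ∧ ChainReach f y x}}

/-- `f` is ball expanding with constants `L`, `δ₀`. -/
def BallExpandingWith {X : Type*} [MetricSpace X] (f : X → X) (L δ₀ : ℝ) : Prop :=
  ∀ (x : X) (δ : ℝ), 0 < δ → δ ≤ δ₀ → closedBall (f x) δ ⊆ f '' closedBall x (L * δ)

/-- `f` is ball expanding: there are `0 < L < 1` and `δ₀ > 0` with
`B_δ(f x) ⊆ f (B_{Lδ} x)` for all `x` and `0 < δ ≤ δ₀`. -/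
def BallExpanding {X : Type*} [MetricSpace X] (f : X → X) : Prop :=
  ∃ L δ₀ : ℝ, 0 < L ∧ L < 1 ∧ 0 < δ₀ ∧ BallExpandingWith f L δ₀

/-- A closed `f`-invariant set `S` is chain stable. -/
def ChainStable {X : Type*} [MetricSpace X] (f : X → X) (S : Set X) : Prop :=
  ∀ ε : ℝ, 0 < ε → ∃ δ : ℝ, 0 < δ ∧ ∀ (c : ℕ → X) (k : ℕ),
    IsDeltaChain f δ c k → c 0 ∈ S → infDist (c k) S ≤ ε

/-- `f` has the h-shadowing property. -/
def HShadowing {X : Type*} [MetricSpace X] (f : X → X) : Prop :=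
  ∀ ε : ℝ, 0 < ε → ∃ δ : ℝ, 0 < δ ∧ ∀ (c : ℕ → X) (k : ℕ), IsDeltaChain f δ c k →
    ∃ x : X, (∀ i < k, dist (f^[i] x) (c i) ≤ ε) ∧ f^[k] x = c k

/-- `f` has the `L`-Lipschitz shadowing property with constant `δ₀`. -/
def LipschitzShadowingWith {X : Type*} [MetricSpace X] (f : X → X) (L δ₀ : ℝ) : Prop :=
  ∀ δ : ℝ, 0 < δ → δ ≤ δ₀ → ∀ ξ : ℕ → X, (∀ i : ℕ, dist (f (ξ i)) (ξ (i + 1)) ≤ δ) →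
    ∃ x : X, ∀ i : ℕ, dist (f^[i] x) (ξ i) ≤ L * δ

/-- `x → y` along `δ`-chains whose length lies in a prescribed residue class modulo `n`. -/
def ChainReachMod {X : Type*} [MetricSpace X] (f : X → X) (n : ℕ) (r : ZMod n) (x y : X) : Prop :=
  ∀ δ : ℝ, 0 < δ → ∃ (c : ℕ → X) (k : ℕ),
    IsDeltaChain f δ c k ∧ c 0 = x ∧ c k = y ∧ (k : ZMod n) = r

theorem IsDeltaChain.mono {X : Type*} [MetricSpace X] {f : X → X} {δ ε : ℝ} {c : ℕ → X} {k : ℕ}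
    (h : IsDeltaChain f δ c k) (hle : δ ≤ ε) : IsDeltaChain f ε c k :=
  ⟨h.1, fun i hi => (h.2 i hi).trans hle⟩

theorem IsDeltaChain.append {X : Type*} [MetricSpace X] {f : X → X} {δ : ℝ} {c d : ℕ → X}
    {k l : ℕ} (hc : IsDeltaChain f δ c k) (hd : IsDeltaChain f δ d l) (h : c k = d 0) :
    IsDeltaChain f δ (fun j => if j < k then c j else d (j - k)) (k + l) := by
  refine ⟨hc.1.trans (Nat.le_add_right k l), fun j hj => ?_⟩
  rcases lt_trichotomy (j + 1) k with hlt | heq | hgt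
  · simpa [hlt, (Nat.lt_succ_self j).trans hlt] using hc.2 j (by omega)
  · have h1 := hc.2 j (by omega)
    rw [heq, h] at h1
    have h2 : j < k := by omega
    simpa [heq, h2] using h1
  · have h1 := hd.2 (j - k) (by omega)
    have h2 : ¬ j < k := by omega
    have h3 : ¬ j + 1 < k := by omega
    have h4 : j + 1 - k = j - k + 1 := by omega
    simpa [h2, h3, h4] using h1

theorem ChainReachMod.trans {X : Type*} [MetricSpace X] {f : X → X} {n : ℕ} {r s : ZMod n}
    {x y z : X} (h : ChainReachMod f n r x y) (h' : ChainReachMod f n s y z) :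
    ChainReachMod f n (r + s) x z := by
  intro δ hδ
  obtain ⟨c, k, hc, hc0, hck, hk⟩ := h δ hδ
  obtain ⟨d, l, hd, hd0, hdl, hl⟩ := h' δ hδ
  refine ⟨_, _, hc.append hd (hck.trans hd0.symm), ?_, ?_, ?_⟩
  · simp [show 0 < k from hc.1, hc0]
  · simp [hdl]
  · simp [hk, hl]

theorem ChainReachMod.chainReach {X : Type*} [MetricSpace X] {f : X → X} {n : ℕ} {r : ZMod n}
    {x y : X} (h : ChainReachMod f n r x y) : ChainReach f x y := fun δ hδ => by
  obtain ⟨c, k, hc, hc0, hck, -⟩ := h δ hδ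
  exact ⟨c, k, hc, hc0, hck⟩

theorem ChainReach.exists_chainReachMod {X : Type*} [MetricSpace X] {f : X → X} {x y : X}
    (h : ChainReach f x y) (n : ℕ) [NeZero n] : ∃ r : ZMod n, ChainReachMod f n r x y := by
  by_contra! hne
  have hbad : ∀ r : ZMod n, ∃ δ : ℝ, 0 < δ ∧ ∀ (c : ℕ → X) (k : ℕ),
      IsDeltaChain f δ c k → c 0 = x → c k = y → (k : ZMod n) ≠ r := by
    intro r
    have := hne r
    simp only [ChainReachMod] at this
    push Not at this
    exact this
  choose δ hδ hno using hbad
  obtain ⟨r₀, hr₀⟩ := Finite.exists_min δ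
  obtain ⟨c, k, hc, hc0, hck⟩ := h (δ r₀) (hδ r₀)
  exact hno (k : ZMod n) c k (hc.mono (hr₀ _)) hc0 hck rfl

theorem ChainReach.trans {X : Type*} [MetricSpace X] {f : X → X} {x y z : X}
    (h : ChainReach f x y) (h' : ChainReach f y z) : ChainReach f x z := by
  obtain ⟨r, hr⟩ := h.exists_chainReachMod 1
  obtain ⟨s, hs⟩ := h'.exists_chainReachMod 1
  exact (hr.trans hs).chainReach

theorem ChainReachMod.loop {X : Type*} [MetricSpace X] {f : X → X} {n : ℕ} {r : ZMod n}
    {x : X} (h : ChainReachMod f n r x x) (m : ℕ) :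
    ChainReachMod f n (((m + 1 : ℕ) : ZMod n) * r) x x := by
  induction m with
  | zero => simpa using h
  | succ m ih =>
    have := ih.trans h
    rwa [show ((m + 1 + 1 : ℕ) : ZMod n) * r = ((m + 1 : ℕ) : ZMod n) * r + r by
      push_cast; ring]

/-- A connection with residue `r` that can be closed up can be closed up with residue `-r`. -/
theorem ChainReachMod.symm_neg {X : Type*} [MetricSpace X] {f : X → X} {n : ℕ} [NeZero n]
    {r : ZMod n} {x y : X} (h : ChainReachMod f n r x y) (h' : ChainReach f y x) :
    ChainReachMod f n (-r) y x := by
  obtain ⟨t, ht⟩ := h'.exists_chainReachMod n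
  -- The loop at `x` is traversed `2 * n - 1` times, which is positive even for `n = 1`.
  have key := ht.trans ((h.trans ht).loop (2 * (n - 1)))
  have hn : ((2 * (n - 1) + 1 : ℕ) : ZMod n) = -1 := by
    have h1 : 2 * (n - 1) + 1 + 1 = 2 * n := by
      have := NeZero.one_le (n := n)
      omega
    have h2 := congrArg (Nat.cast : ℕ → ZMod n) h1
    rw [Nat.cast_add_one, Nat.cast_mul, ZMod.natCast_self, mul_zero] at h2
    exact eq_neg_of_add_eq_zero_left h2
  rwa [hn, show t + -1 * (r + t) = -r by ring] at key

theorem exists_dist_iterate_le {X : Type*} [MetricSpace X] {f : X → X} (hf : UniformContinuous f)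
    (n : ℕ) : ∀ ε : ℝ, 0 < ε → ∃ δ : ℝ, 0 < δ ∧ ∀ c : ℕ → X,
      (∀ j < n, dist (f (c j)) (c (j + 1)) ≤ δ) → dist (f^[n] (c 0)) (c n) ≤ ε := by
  induction n with
  | zero => exact fun ε hε => ⟨1, one_pos, fun c _ => by simpa using hε.le⟩
  | succ n ih =>
    intro ε hε
    obtain ⟨η, hη, hfη⟩ := Metric.uniformContinuous_iff.1 hf (ε / 2) (half_pos hε)
    obtain ⟨δ, hδ, hc⟩ := ih (η / 2) (half_pos hη)
    refine ⟨min δ (ε / 2), lt_min hδ (half_pos hε), fun c h => ?_⟩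
    have h1 := hc c fun j hj => (h j (by omega)).trans (min_le_left _ _)
    have h2 := hfη (h1.trans_lt (half_lt_self hη))
    have h3 := (h n (by omega)).trans (min_le_right _ _)
    rw [Function.iterate_succ_apply']
    linarith [dist_triangle (f (f^[n] (c 0))) (f (c n)) (c (n + 1))]

theorem ChainReachMod.chainReach_iterate {X : Type*} [MetricSpace X] {f : X → X}
    (hf : UniformContinuous f) {n : ℕ} {x y : X} (h : ChainReachMod f n 0 x y) :
    ChainReach f^[n] x y := by
  intro ε hε
  obtain ⟨δ, hδ, hfδ⟩ := exists_dist_iterate_le hf n ε hε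
  obtain ⟨c, k, hc, hc0, hck, hk⟩ := h δ hδ
  obtain ⟨m, rfl⟩ := (ZMod.natCast_eq_zero_iff k n).1 hk
  refine ⟨fun j => c (n * j), m, ⟨?_, fun j hj => ?_⟩, by simpa using hc0, hck⟩
  · exact Nat.pos_of_ne_zero fun h0 => by simpa [h0] using hc.1
  · refine hfδ (fun l => c (n * j + l)) fun l hl => hc.2 _ ?_
    calc n * j + l < n * (j + 1) := by rw [Nat.mul_succ]; omega
      _ ≤ n * m := Nat.mul_le_mul_left n hj

theorem ChainReach.of_iterate {X : Type*} [MetricSpace X] {f : X → X} {n : ℕ} (hn : 1 ≤ n)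
    {x y : X} (h : ChainReach f^[n] x y) : ChainReach f x y := by
  intro δ hδ
  obtain ⟨c, k, hc, hc0, hck⟩ := h δ hδ
  refine ⟨fun j => f^[j % n] (c (j / n)), k * n, ⟨Nat.mul_pos hc.1 hn, fun j hj => ?_⟩,
    by simpa using hc0, by simpa [Nat.mul_div_cancel k hn] using hck⟩
  have hmod : j % n < n := Nat.mod_lt j hn
  have hj' := Nat.div_add_mod j n
  have hq : j / n < k := Nat.div_lt_of_lt_mul (by rwa [Nat.mul_comm])
  dsimp only
  generalize j / n = q at *
  generalize j % n = r at *
  subst hj'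
  rw [← Function.iterate_succ_apply' f]
  rcases Nat.lt_or_ge (r + 1) n with hr | hr
  · have h1 : (n * q + r + 1) / n = q := by
      rw [add_assoc, Nat.mul_add_div hn, Nat.div_eq_of_lt hr, add_zero]
    have h2 : (n * q + r + 1) % n = r + 1 := by
      rw [add_assoc, Nat.mul_add_mod, Nat.mod_eq_of_lt hr]
    rw [h1, h2, dist_self]
    exact hδ.le
  · have hr' : r + 1 = n := by omega
    have h0 : n * q + r + 1 = n * (q + 1) := by rw [add_assoc, hr', Nat.mul_succ]
    rw [h0, Nat.mul_div_cancel_left _ hn, Nat.mul_mod_right, Nat.succ_eq_add_one, hr']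
    exact hc.2 q hq

theorem chainRecurrentSet_iterate {X : Type*} [MetricSpace X] {f : X → X}
    (hf : UniformContinuous f) {n : ℕ} (hn : 1 ≤ n) :
    chainRecurrentSet f^[n] = chainRecurrentSet f := by
  have : NeZero n := ⟨by omega⟩
  refine Set.Subset.antisymm (fun x hx => ChainReach.of_iterate hn hx) fun x hx => ?_
  obtain ⟨r, hr⟩ := ChainReach.exists_chainReachMod hx n
  have := hr.trans (hr.symm_neg hx)
  rw [add_neg_cancel] at this
  exact this.chainReach_iterate hf

/-- The points of the chain recurrent set that are chain equivalent to `x`. -/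
def chainClass {X : Type*} [MetricSpace X] (f : X → X) (x : X) : Set X :=
  {y ∈ chainRecurrentSet f | ChainReach f x y ∧ ChainReach f y x}

theorem chainComponents_eq_image {X : Type*} [MetricSpace X] (f : X → X) :
    chainComponents f = chainClass f '' chainRecurrentSet f := by
  ext C
  exact exists_congr fun x => and_congr_right fun _ => eq_comm

theorem chainClass_eq_iff {X : Type*} [MetricSpace X] {f : X → X} {x y : X}
    (hy : y ∈ chainRecurrentSet f) :
    chainClass f x = chainClass f y ↔ ChainReach f x y ∧ ChainReach f y x := by
  constructor
  · intro h
    have : y ∈ chainClass f y := ⟨hy, hy, hy⟩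
    rw [← h] at this
    exact this.2
  · rintro ⟨hxy, hyx⟩
    ext z
    exact and_congr_right fun _ =>
      ⟨fun h => ⟨hyx.trans h.1, h.2.trans hxy⟩, fun h => ⟨hxy.trans h.1, h.2.trans hyx⟩⟩

/-- For a continuous map `f` on a compact metric space and `i ≥ 1`, the set of chain
components of `f` is finite iff the set of chain components of `f^i` is finite. -/
theorem chainComponents_finite_iff_iterate {X : Type*} [MetricSpace X] [CompactSpace X]
    (f : X → X) (hf : Continuous f) (i : ℕ) (hi : 1 ≤ i) :
    (chainComponents f).Finite ↔ (chainComponents (f^[i])).Finite := by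
  have huc := CompactSpace.uniformContinuous_of_continuous hf
  have : NeZero i := ⟨by omega⟩
  rw [chainComponents_eq_image, chainComponents_eq_image, chainRecurrentSet_iterate huc hi]
  rcases isEmpty_or_nonempty X with hX | hX
  · exact ⟨fun _ => Set.toFinite _, fun _ => Set.toFinite _⟩
  constructor
  · intro hfin
    have hbase : ∀ C ∈ chainClass f '' chainRecurrentSet f,
        ∃ x ∈ chainRecurrentSet f, chainClass f x = C := fun C hC => hC
    choose! base hbase hbaseC using hbase
    have hb : ∀ y ∈ chainRecurrentSet f, ChainReach f (base (chainClass f y)) y ∧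
        ChainReach f y (base (chainClass f y)) := fun y hy =>
      (chainClass_eq_iff hy).1 (hbaseC _ (mem_image_of_mem _ hy))
    have hres : ∀ y ∈ chainRecurrentSet f, ∃ r : ZMod i,
        ChainReachMod f i r (base (chainClass f y)) y := fun y hy =>
      (hb y hy).1.exists_chainReachMod i
    choose! res hres using hres
    have hrep : ∀ D ∈ chainClass f^[i] '' chainRecurrentSet f,
        ∃ y ∈ chainRecurrentSet f, chainClass f^[i] y = D := fun D hD => hD
    choose! rep hrep hrepD using hrep
    have hreach : ∀ y ∈ chainRecurrentSet f, ∀ z ∈ chainRecurrentSet f,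
        chainClass f y = chainClass f z → res y = res z → ChainReach f^[i] y z := by
      intro y hy z hz hC hr
      have h := ((hres y hy).symm_neg (hb y hy).2).trans (hC ▸ hres z hz)
      rw [hr, neg_add_cancel] at h
      exact h.chainReach_iterate huc
    refine Set.Finite.of_injOn (f := fun D => (chainClass f (rep D), res (rep D)))
      (t := (chainClass f '' chainRecurrentSet f) ×ˢ Set.univ)
      (fun D hD => ⟨mem_image_of_mem _ (hrep D hD), mem_univ _⟩) ?_ (hfin.prod Set.finite_univ)
    intro D hD E hE hDE
    obtain ⟨hC, hr⟩ := Prod.mk.inj hDE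
    rw [← hrepD D hD, ← hrepD E hE, chainClass_eq_iff
      (by rw [chainRecurrentSet_iterate huc hi]; exact hrep E hE)]
    exact ⟨hreach _ (hrep D hD) _ (hrep E hE) hC hr,
      hreach _ (hrep E hE) _ (hrep D hD) hC.symm hr.symm⟩
  · intro hfin
    have hrep : ∀ C ∈ chainClass f '' chainRecurrentSet f,
        ∃ y ∈ chainRecurrentSet f, chainClass f y = C := fun C hC => hC
    choose! rep hrep hrepC using hrep
    refine Set.Finite.of_injOn (f := fun C => chainClass f^[i] (rep C))
      (fun C hC => mem_image_of_mem _ (hrep C hC)) ?_ hfin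
    intro C hC E hE hCE
    have h := (chainClass_eq_iff
      (by rw [chainRecurrentSet_iterate huc hi]; exact hrep E hE)).1 hCE
    rw [← hrepC C hC, ← hrepC E hE, chainClass_eq_iff (hrep E hE)]
    exact ⟨h.1.of_iterate hi, h.2.of_iterate hi⟩
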